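/- Consider the problem ${\rm APP} = \{{\rm APP}_{\infty,d}\}_{d \in \mathbb{N}}$ in the worst case setting for the absolute or normalized error criterion $\star \in \{{\rm ABS}, {\rm NOR}\}$. Then ${\rm APP}$ is exponentially quasi-polynomially tractable (EXP-QPT) for $\Lambda^{\rm all}$ if and only if it is EXP-QPT for $\Lambda^{\rm std}$. -/

import Mathlib

open Filter
open scoped ENNReal NNReal

noncomputable section

/-- Coefficient space: `ℓ²` sequences indexed by `ℤ^d`.  An element `u` represents the
function `f ∈ H^ω(𝕋^d)` with Fourier coefficients `f̂(k) = u k / ω k`, so that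
`‖u‖_{ℓ²} = ‖f‖_{H^ω}`. -/
abbrev Coef (d : ℕ) := lp (fun _ : Fin d → ℤ => ℂ) 2

/-- The periodic function represented by the coefficients `u`:
`f(x) = ∑_{k ∈ ℤ^d} (u k / ω k) e^{2πi k·x}`. -/
def torusFn {d : ℕ} (ω : (Fin d → ℤ) → ℝ) (u : Coef d) (x : Fin d → ℝ) : ℂ :=
  ∑' k : Fin d → ℤ,
    ((ω k : ℂ))⁻¹ * u k * Complex.exp (2 * Real.pi * Complex.I * ∑ j, (k j : ℂ) * (x j : ℂ))

/-- The torus `𝕋^d`, modelled as the cube `[0,1]^d`. -/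
def cube (d : ℕ) : Set (Fin d → ℝ) := {x | ∀ j, x j ∈ Set.Icc (0 : ℝ) 1}

/-- Standard information: point-evaluation functionals `f ↦ f(x)`. -/
def stdInfo {d : ℕ} (ω : (Fin d → ℤ) → ℝ) : Set (Coef d → ℂ) :=
  {L | ∃ x ∈ cube d, L = fun u => torusFn ω u x}

/-- General linear information: all continuous linear functionals on `H^ω`. -/
def allInfo (d : ℕ) : Set (Coef d → ℂ) := {L | ∃ T : Coef d →L[ℂ] ℂ, L = ⇑T}

/-- The `n`-th minimal worst case error `e(n, APP_{∞,d}; Λ)` of `L_∞`-approximation on the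
unit ball of `H^ω(𝕋^d)`, using algorithms `f ↦ φ(L₁ f, …, Lₙ f)` with `Lᵢ ∈ Λ`. -/
def wcErr {d : ℕ} (ω : (Fin d → ℤ) → ℝ) (Λ : Set (Coef d → ℂ)) (n : ℕ) : ℝ≥0∞ :=
  ⨅ (L : Fin n → Coef d → ℂ) (_ : ∀ i, L i ∈ Λ) (φ : (Fin n → ℂ) → (Fin d → ℝ) → ℂ),
    ⨆ (u : Coef d) (_ : ‖u‖ ≤ 1) (x : Fin d → ℝ) (_ : x ∈ cube d),
      (‖torusFn ω u x - φ (fun i => L i u) x‖₊ : ℝ≥0∞)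

/-- The initial error `e(0, APP_{∞,d}) = sup_{‖f‖_{H^ω} ≤ 1} ‖f‖_∞`. -/
def initErr {d : ℕ} (ω : (Fin d → ℤ) → ℝ) : ℝ≥0∞ :=
  ⨆ (u : Coef d) (_ : ‖u‖ ≤ 1) (x : Fin d → ℝ) (_ : x ∈ cube d),
    (‖torusFn ω u x‖₊ : ℝ≥0∞)

/-- The error criterion: absolute (ABS) or normalized (NOR). -/
inductive Crit | ABS | NOR

/-- `CRI_d`: the normalizing quantity of the error criterion. -/
def CRI {d : ℕ} (ω : (Fin d → ℤ) → ℝ) : Crit → ℝ≥0∞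
  | Crit.ABS => 1
  | Crit.NOR => initErr ω

/-- The information complexity `n^⋆(ε, d; Λ)`. -/
def infoComp {d : ℕ} (ω : (Fin d → ℤ) → ℝ) (Λ : Set (Coef d → ℂ)) (crit : Crit) (ε : ℝ) : ℕ :=
  sInf {n : ℕ | wcErr ω Λ n ≤ ENNReal.ofReal ε * CRI ω crit}

/-- Algebraic strong polynomial tractability of the family of information complexities `nc`. -/
def ALGSPT (nc : ℕ → ℝ → ℕ) : Prop :=
  ∃ C > (0:ℝ), ∃ p ≥ (0:ℝ), ∀ d : ℕ, 0 < d → ∀ ε ∈ Set.Ioo (0:ℝ) 1,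
    (nc d ε : ℝ) ≤ C * ε ^ (-p)

/-- The exponent of algebraic strong polynomial tractability. -/
def ALGSPTexp (nc : ℕ → ℝ → ℕ) : ℝ :=
  sInf {p : ℝ | 0 ≤ p ∧ ∃ C > (0:ℝ), ∀ d : ℕ, 0 < d → ∀ ε ∈ Set.Ioo (0:ℝ) 1,
    (nc d ε : ℝ) ≤ C * ε ^ (-p)}

/-- Algebraic polynomial tractability. -/
def ALGPT (nc : ℕ → ℝ → ℕ) : Prop :=
  ∃ C > (0:ℝ), ∃ p ≥ (0:ℝ), ∃ q ≥ (0:ℝ), ∀ d : ℕ, 0 < d → ∀ ε ∈ Set.Ioo (0:ℝ) 1,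
    (nc d ε : ℝ) ≤ C * (d : ℝ) ^ q * ε ^ (-p)

/-- Algebraic quasi-polynomial tractability. -/
def ALGQPT (nc : ℕ → ℝ → ℕ) : Prop :=
  ∃ C > (0:ℝ), ∃ t ≥ (0:ℝ), ∀ d : ℕ, 0 < d → ∀ ε ∈ Set.Ioo (0:ℝ) 1,
    (nc d ε : ℝ) ≤ C * Real.exp (t * (1 + Real.log d) * (1 + Real.log ε⁻¹))

/-- The exponent of algebraic quasi-polynomial tractability. -/
def ALGQPTexp (nc : ℕ → ℝ → ℕ) : ℝ :=
  sInf {t : ℝ | 0 ≤ t ∧ ∃ C > (0:ℝ), ∀ d : ℕ, 0 < d → ∀ ε ∈ Set.Ioo (0:ℝ) 1,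
    (nc d ε : ℝ) ≤ C * Real.exp (t * (1 + Real.log d) * (1 + Real.log ε⁻¹))}

/-- Exponential quasi-polynomial tractability. -/
def EXPQPT (nc : ℕ → ℝ → ℕ) : Prop :=
  ∃ C > (0:ℝ), ∃ t ≥ (0:ℝ), ∀ d : ℕ, 0 < d → ∀ ε ∈ Set.Ioo (0:ℝ) 1,
    (nc d ε : ℝ) ≤ C * Real.exp (t * (1 + Real.log d) * (1 + Real.log (Real.log ε⁻¹ + 1)))

/-- The exponent of exponential quasi-polynomial tractability. -/
def EXPQPTexp (nc : ℕ → ℝ → ℕ) : ℝ :=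
  sInf {t : ℝ | 0 ≤ t ∧ ∃ C > (0:ℝ), ∀ d : ℕ, 0 < d → ∀ ε ∈ Set.Ioo (0:ℝ) 1,
    (nc d ε : ℝ) ≤ C * Real.exp (t * (1 + Real.log d) * (1 + Real.log (Real.log ε⁻¹ + 1)))}

/-- `lim_{ε⁻¹ + d → ∞} (log nc(d, ε)) / den(d, ε) = 0`. -/
def WTlim (den : ℕ → ℝ → ℝ) (nc : ℕ → ℝ → ℕ) : Prop :=
  ∀ δ > (0:ℝ), ∃ M : ℝ, ∀ d : ℕ, 0 < d → ∀ ε ∈ Set.Ioo (0:ℝ) 1,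
    M ≤ ε⁻¹ + d → |Real.log (nc d ε) / den d ε| < δ

/-- Algebraic `(s,t)`-weak tractability; `ALGWTst 1 1` is algebraic weak tractability. -/
def ALGWTst (s t : ℝ) (nc : ℕ → ℝ → ℕ) : Prop :=
  WTlim (fun d ε => ε ^ (-s) + (d : ℝ) ^ t) nc

/-- Algebraic uniform weak tractability. -/
def ALGUWT (nc : ℕ → ℝ → ℕ) : Prop := ∀ α > (0:ℝ), ∀ β > (0:ℝ), ALGWTst α β nc

/-- Exponential `(s,t)`-weak tractability; `EXPWTst 1 1` is exponential weak tractability. -/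
def EXPWTst (s t : ℝ) (nc : ℕ → ℝ → ℕ) : Prop :=
  WTlim (fun d ε => (1 + Real.log ε⁻¹) ^ s + (d : ℝ) ^ t) nc

/-- Exponential uniform weak tractability. -/
def EXPUWT (nc : ℕ → ℝ → ℕ) : Prop := ∀ α > (0:ℝ), ∀ β > (0:ℝ), EXPWTst α β nc


open MeasureTheory in
theorem cs_tsum {ι : Type*} (f g : ι → ℝ) (hf : ∀ i, 0 ≤ f i) (hg : ∀ i, 0 ≤ g i)
    (hf2 : Summable fun i => f i ^ 2) (hg2 : Summable fun i => g i ^ 2) :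
    Summable (fun i => f i * g i) ∧ (∑' i, f i * g i) ^ 2 ≤ (∑' i, f i ^ 2) * ∑' i, g i ^ 2 := by
  have h := Real.summable_and_inner_le_Lp_mul_Lq_tsum_of_nonneg (f := f) (g := g)
    Real.HolderConjugate.two_two hf hg (by simpa using hf2) (by simpa using hg2)
  refine ⟨h.1, ?_⟩
  have h2 := h.2
  simp only [Real.rpow_ofNat, ← Real.sqrt_eq_rpow] at h2
  have h0 : 0 ≤ ∑' i, f i * g i := tsum_nonneg fun i => mul_nonneg (hf i) (hg i)
  have hF : 0 ≤ ∑' i, f i ^ 2 := tsum_nonneg fun i => sq_nonneg _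
  have hG : 0 ≤ ∑' i, g i ^ 2 := tsum_nonneg fun i => sq_nonneg _
  calc _ ≤ (√(∑' i, f i ^ 2) * √(∑' i, g i ^ 2)) ^ 2 := by gcongr
    _ = _ := by rw [mul_pow, Real.sq_sqrt hF, Real.sq_sqrt hG]

def ee {d : ℕ} (m : Fin d → ℤ) (x : Fin d → ℝ) : ℂ :=
  Complex.exp (2 * Real.pi * Complex.I * ∑ j, (m j : ℂ) * (x j : ℂ))

theorem ee_norm {d : ℕ} (m : Fin d → ℤ) (x : Fin d → ℝ) : ‖ee m x‖ = 1 := by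
  unfold ee
  have : (2 * Real.pi * Complex.I * ∑ j, (m j : ℂ) * (x j : ℂ))
    = ((2 * Real.pi * ∑ j, (m j : ℝ) * (x j : ℝ) : ℝ) : ℂ) * Complex.I := by
    push_cast; ring
  rw [this, Complex.norm_exp_ofReal_mul_I]

theorem ee_zero {d : ℕ} (x : Fin d → ℝ) : ee 0 x = 1 := by simp [ee]

theorem ee_add {d : ℕ} (m n : Fin d → ℤ) (x : Fin d → ℝ) : ee (m + n) x = ee m x * ee n x := by
  unfold ee
  rw [← Complex.exp_add]
  congr 1
  simp only [Pi.add_apply, Int.cast_add, add_mul, Finset.sum_add_distrib]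
  ring

theorem ee_neg {d : ℕ} (m : Fin d → ℤ) (x : Fin d → ℝ) :
    ee (-m) x = (starRingEnd ℂ) (ee m x) := by
  unfold ee
  rw [← Complex.exp_conj]
  simp [Complex.conj_ofNat]

theorem ee_sub {d : ℕ} (m n : Fin d → ℤ) (x : Fin d → ℝ) :
    ee (m - n) x = ee m x * (starRingEnd ℂ) (ee n x) := by
  rw [sub_eq_add_neg, ee_add, ee_neg]

theorem ee_cont {d : ℕ} (m : Fin d → ℤ) : Continuous (ee m) := by
  unfold ee; fun_prop

open MeasureTheory

def muc (d : ℕ) : Measure (Fin d → ℝ) := Measure.pi fun _ => volume.restrict (Set.Icc (0:ℝ) 1)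

instance (d : ℕ) : IsProbabilityMeasure (muc d) := by
  have : IsProbabilityMeasure ((volume : Measure ℝ).restrict (Set.Icc (0:ℝ) 1)) :=
    ⟨by simp⟩
  unfold muc; infer_instance

theorem muc_cube (d : ℕ) : muc d (cube d)ᶜ = 0 := by
  have : cube d = Set.pi Set.univ (fun _ => Set.Icc (0:ℝ) 1) := by
    ext x; simp only [cube, Set.mem_pi, Set.mem_ofPred_eq, Set.mem_univ, true_imp_iff]
  have h2 : muc d = (volume : Measure (Fin d → ℝ)).restrict (cube d) := by
    rw [this, volume_pi, muc, Measure.restrict_pi_pi]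
  rw [h2, Measure.restrict_apply, Set.compl_inter_self, measure_empty]
  rw [this]
  exact (MeasurableSet.univ_pi fun _ => measurableSet_Icc).compl

theorem int_exp (n : ℤ) (hn : n ≠ 0) :
    ∫ t in Set.Icc (0:ℝ) 1, Complex.exp (2 * Real.pi * Complex.I * ((n : ℂ) * (t : ℂ))) = 0 := by
  rw [integral_Icc_eq_integral_Ioc, ← intervalIntegral.integral_of_le zero_le_one]
  have hc : (2 * Real.pi * Complex.I * n : ℂ) ≠ 0 := by
    simp [Real.pi_ne_zero, hn]
  have := integral_exp_mul_complex (a := 0) (b := 1) hc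
  simp only [← mul_assoc]
  rw [this]
  have h1 : Complex.exp (2 * Real.pi * Complex.I * n) = 1 := by
    rw [mul_comm]; exact Complex.exp_int_mul_two_pi_mul_I n
  simp [h1]

theorem int_ee {d : ℕ} (m : Fin d → ℤ) : ∫ x, ee m x ∂(muc d) = if m = 0 then 1 else 0 := by
  split_ifs with h
  · subst h; simp [ee_zero]
  · have : ∀ x, ee m x = ∏ j, Complex.exp (2 * Real.pi * Complex.I * ((m j : ℂ) * (x j : ℂ))) := by
      intro x; rw [ee, Finset.mul_sum, Complex.exp_sum]
    simp_rw [this]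
    rw [muc, integral_fintype_prod_eq_prod
      (fun j (t : ℝ) => Complex.exp (2 * Real.pi * Complex.I * ((m j : ℂ) * (t : ℂ))))]
    obtain ⟨j, hj⟩ := Function.ne_iff.1 h
    exact Finset.prod_eq_zero (Finset.mem_univ j) (int_exp _ hj)

theorem avg {d : ℕ} {P : Type*} [Countable P] (c : P → ℂ) (m : P → Fin d → ℤ)
    (hc : Summable fun p => ‖c p‖) :
    ∃ x ∈ cube d, (∑' p, c p * ee (m p) x).re ≤ (∑' p, if m p = 0 then c p else 0).re := by
  have hi : ∀ p, Integrable (fun x => c p * ee (m p) x) (muc d) := by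
    intro p
    refine Integrable.of_bound (C := ‖c p‖) ?_ ?_
    · exact (continuous_const.mul (ee_cont _)).aestronglyMeasurable
    · exact ae_of_all _ fun x => by simp [ee_norm]
  have hs := hasSum_integral_of_summable_integral_norm hi (by simpa [ee_norm] using hc)
  have hcont : Continuous fun x => ∑' p, c p * ee (m p) x :=
    continuous_tsum (fun p => continuous_const.mul (ee_cont _)) hc (fun p x => by simp [ee_norm])
  have hb : ∀ x, ‖∑' p, c p * ee (m p) x‖ ≤ ∑' p, ‖c p‖ := by
    intro x
    refine (norm_tsum_le_tsum_norm (by simpa [ee_norm] using hc)).trans ?_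
    simp [ee_norm]
  have hI : Integrable (fun x => ∑' p, c p * ee (m p) x) (muc d) :=
    Integrable.of_bound hcont.aestronglyMeasurable _ (ae_of_all _ hb)
  obtain ⟨x, hx, hle⟩ := exists_notMem_null_le_integral hI.re (muc_cube d)
  refine ⟨x, by simpa using hx, ?_⟩
  have e1 : ∫ x, RCLike.re (∑' p, c p * ee (m p) x) ∂(muc d) 
    = (∑' p, if m p = 0 then c p else 0).re := by
    rw [integral_re hI, ← hs.tsum_eq]
    have e2 : ∀ p, ∫ x, c p * ee (m p) x ∂(muc d) = if m p = 0 then c p else 0 := by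
      intro p
      rw [integral_const_mul, int_ee]
      simp
    simp_rw [e2]
    rfl
  rw [← e1]
  exact hle


theorem sum_ee_norm_le {d M : ℕ} (m : Fin d → ℤ) (x : Fin M → Fin d → ℝ) :
    ‖∑ i, ee m (x i)‖ ≤ M := by
  refine (norm_sum_le _ _).trans ?_
  simp [ee_norm]

theorem summ_W {d M : ℕ} {P : Type*} (W : P → ℝ) (hW : ∀ p, 0 ≤ W p) (hs : Summable W)
    (m : P → Fin d → ℤ) (x : Fin M → Fin d → ℝ) :
    Summable fun p => W p * ‖∑ i, ee (m p) (x i)‖ ^ 2 := by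
  refine Summable.of_nonneg_of_le (fun p => mul_nonneg (hW p) (sq_nonneg _)) (fun p => ?_)
    (hs.mul_right ((M : ℝ) ^ 2))
  have := sum_ee_norm_le (m p) x
  have := hW p
  gcongr

theorem greedy {d : ℕ} {P : Type*} [Countable P] (W : P → ℝ) (hW : ∀ p, 0 ≤ W p)
    (hs : Summable W) (m : P → Fin d → ℤ) (hm : ∀ p, m p = 0 → W p = 0) (M : ℕ) :
    ∃ x : Fin M → Fin d → ℝ, (∀ i, x i ∈ cube d) ∧
      ∑' p, W p * ‖∑ i, ee (m p) (x i)‖ ^ 2 ≤ M * ∑' p, W p := by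
  induction M with
  | zero => exact ⟨fun i => i.elim0, fun i => i.elim0, by simp⟩
  | succ M ih =>
    obtain ⟨x, hx, hle⟩ := ih
    have hcs : Summable fun p => ‖(W p : ℂ) * (starRingEnd ℂ) (∑ i, ee (m p) (x i))‖ := by
      refine Summable.of_nonneg_of_le (fun p => norm_nonneg _) (fun p => ?_) (hs.mul_right (M : ℝ))
      rw [norm_mul, RCLike.norm_conj, Complex.norm_real, Real.norm_of_nonneg (hW p)]
      have := hW p
      have := sum_ee_norm_le (m p) x
      gcongr
    obtain ⟨y, hy, hyle⟩ := avg (fun p => (W p : ℂ) * (starRingEnd ℂ) (∑ i, ee (m p) (x i))) m hcs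
    have hz : (∑' p, if m p = 0 then (W p : ℂ) * (starRingEnd ℂ) (∑ i, ee (m p) (x i)) else 0) = 0 := by
      refine (tsum_congr fun p => ?_).trans tsum_zero
      split_ifs with h
      · simp [hm p h]
      · rfl
    rw [hz] at hyle
    refine ⟨Fin.cons y x, ?_, ?_⟩
    · intro i
      refine Fin.cases ?_ (fun i => ?_) i
      · simpa using hy
      · simpa using hx i
    · have hsy : Summable fun p => (W p : ℂ) * (starRingEnd ℂ) (∑ i, ee (m p) (x i)) * ee (m p) y := by
        apply Summable.of_norm
        simpa only [norm_mul _ (ee _ _), ee_norm, mul_one] using hcs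
      have hre := Complex.hasSum_re hsy.hasSum
      have e : ∀ p, W p * ‖∑ i, ee (m p) ((Fin.cons y x : Fin (M+1) → Fin d → ℝ) i)‖ ^ 2 =
        (W p * ‖∑ i, ee (m p) (x i)‖ ^ 2 + W p) +
          2 * ((W p : ℂ) * (starRingEnd ℂ) (∑ i, ee (m p) (x i)) * ee (m p) y).re := by
        intro p
        rw [Fin.sum_univ_succ]
        simp only [Fin.cons_zero, Fin.cons_succ]
        rw [mul_assoc, Complex.re_ofReal_mul, ← Complex.normSq_eq_norm_sq, Complex.normSq_add,
          Complex.normSq_eq_norm_sq, ee_norm, ← Complex.normSq_eq_norm_sq,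
          ← Complex.conj_re (ee (m p) y * _), map_mul, Complex.conj_conj,
          mul_comm ((starRingEnd ℂ) (ee (m p) y)), ← Complex.conj_re]
        simp only [map_mul, Complex.conj_conj]
        ring
      simp_rw [e]
      rw [((( summ_W W hW hs m x).add hs).tsum_add (hre.summable.mul_left 2)),
        (summ_W W hW hs m x).tsum_add hs, tsum_mul_left, hre.tsum_eq]
      simp only [Complex.zero_re] at hyle
      push_cast
      linarith

theorem summ_b {d : ℕ} {ω : (Fin d → ℤ) → ℝ} (hs : Summable fun k => ((ω k) ^ 2)⁻¹)
    (u : Coef d) : Summable fun k => ‖((ω k : ℂ))⁻¹ * u k‖ := by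
  have hu : Summable fun k => ‖u k‖ ^ 2 := by
    simpa using (lp.memℓp u).summable (by norm_num)
  have := (cs_tsum (fun k => |ω k|⁻¹) (fun k => ‖u k‖) (fun _ => by positivity)
    (fun _ => norm_nonneg _) (by simpa using hs) hu).1
  simpa using this

theorem norm_sq_coef {d : ℕ} (u : Coef d) : HasSum (fun k => ‖u k‖ ^ 2) (‖u‖ ^ 2) := by
  have := lp.hasSum_norm (p := 2) (by norm_num) u
  simpa using this

theorem torus_eq {d : ℕ} (ω : (Fin d → ℤ) → ℝ) (u : Coef d) (x : Fin d → ℝ) :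
  torusFn ω u x = ∑' k, ((ω k : ℂ))⁻¹ * u k * ee k x := rfl

theorem torus_sub {d : ℕ} {ω : (Fin d → ℤ) → ℝ} (hs : Summable fun k => ((ω k) ^ 2)⁻¹)
    (u v : Coef d) (x : Fin d → ℝ) : torusFn ω (u - v) x = torusFn ω u x - torusFn ω v x := by
  have h : ∀ u : Coef d, Summable fun k => ((ω k : ℂ))⁻¹ * u k * ee k x := fun u =>
    Summable.of_norm (by simpa only [norm_mul _ (ee _ _), ee_norm, mul_one] using summ_b hs u)
  rw [torus_eq, torus_eq, torus_eq, ← (h u).tsum_sub (h v)]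
  congr 1; ext1 k
  simp only [lp.coeFn_sub, Pi.sub_apply]
  ring

set_option maxHeartbeats 1000000 in
theorem points {d : ℕ} (ω : (Fin d → ℤ) → ℝ) (hpos : ∀ k, 0 < ω k)
    (hs : Summable fun k => ((ω k) ^ 2)⁻¹) (S : Finset (Fin d → ℤ)) (hn : 0 < S.card)
    (τ2 : ℝ) (hτ : HasSum (fun k => if k ∈ S then 0 else ((ω k) ^ 2)⁻¹) τ2) (hτ0 : 0 < τ2) :
    ∃ x : Fin (8 * S.card ^ 2) → Fin d → ℝ, (∀ i, x i ∈ cube d) ∧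
      ∀ u : Coef d, ‖u‖ ≤ 2 → (∀ i, torusFn ω u (x i) = 0) →
        S.card * ∑ k ∈ S, ‖((ω k : ℂ))⁻¹ * u k‖ ^ 2 ≤ 4 / 3 * τ2 := by
  classical
  set n := S.card with hndef
  set M := 8 * n ^ 2 with hM
  have hnr : (0:ℝ) < n := by exact_mod_cast hn
  -- weights
  set w : (Fin d → ℤ) → ℝ := fun l => if l ∈ S then τ2 else n * ((ω l) ^ 2)⁻¹ with hw
  have hwpos : ∀ l, 0 < w l := by
    intro l
    have := hpos l
    simp only [hw]; split_ifs <;> positivity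
  have hwsum : HasSum w (n * τ2 + n * τ2) := by
    have h1 : HasSum (fun l => if l ∈ S then τ2 else 0) (∑ l ∈ S, if l ∈ S then τ2 else 0) :=
      hasSum_sum_of_ne_finset_zero (fun l hl => by simp [hl])
    have h2 : (∑ l ∈ S, if l ∈ S then τ2 else 0) = n * τ2 := by
      simp [hndef]
    rw [h2] at h1
    convert h1.add (hτ.mul_left (n:ℝ)) using 1
    ext l
    simp only [hw]; split_ifs <;> simp
  let W : S × (Fin d → ℤ) → ℝ := fun p => if p.2 = p.1 then 0 else w p.2
  have hW0 : ∀ p, 0 ≤ W p := by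
    intro p; simp only [W]; split_ifs
    · rfl
    · exact (hwpos _).le
  have hWle : ∀ p, W p ≤ w p.2 := by
    intro p; simp only [W]; split_ifs
    · exact (hwpos _).le
    · rfl
  have hWfib : ∀ k : S, Summable fun l => W (k, l) := fun k =>
    Summable.of_nonneg_of_le (fun l => hW0 _) (fun l => hWle _) hwsum.summable
  have hWs : Summable W := by
    rw [summable_prod_of_nonneg hW0]
    exact ⟨hWfib, Summable.of_finite⟩
  have hWtot : ∑' p, W p ≤ n * (n * τ2 + n * τ2) := by
    rw [hWs.tsum_prod, tsum_fintype]
    calc _ ≤ ∑ k : S, (n * τ2 + n * τ2) := by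
          refine Finset.sum_le_sum fun k _ => ?_
          rw [← hwsum.tsum_eq]
          exact (hWfib k).tsum_le_tsum (fun l => hWle _) hwsum.summable
      _ = _ := by simp [hndef]; ring
  obtain ⟨x, hx, hZ⟩ := greedy W hW0 hWs (fun p => p.2 - (p.1 : Fin d → ℤ))
    (fun p hp => by simp [W, sub_eq_zero.1 hp]) M
  refine ⟨x, hx, fun u hu hz => ?_⟩
  have hZs := summ_W W hW0 hWs (fun p => p.2 - (p.1 : Fin d → ℤ)) x
  set D : (Fin d → ℤ) → ℂ := fun m => ∑ i, ee m (x i) with hD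
  set b : (Fin d → ℤ) → ℂ := fun k => ((ω k : ℂ))⁻¹ * u k with hb
  have hbs : Summable fun k => ‖b k‖ := summ_b hs u
  have hbe : ∀ y, Summable fun l => b l * ee l y := fun y =>
    Summable.of_norm (by simpa only [norm_mul _ (ee _ _), ee_norm, mul_one] using hbs)
  have hfib : ∀ k : S, Summable fun l => W (k, l) * ‖D (l - k)‖ ^ 2 := fun k =>
    hZs.prod_factor k
  have hZ2 : ∑ k : S, ∑' l, W (k, l) * ‖D (l - k)‖ ^ 2 ≤ M ^ 2 * τ2 / 4 := by
    rw [hZs.tsum_prod, tsum_fintype] at hZ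
    refine hZ.trans ?_
    have : (M : ℝ) = 8 * n ^ 2 := by simp [hM]
    calc (M:ℝ) * ∑' p, W p ≤ M * (n * (n * τ2 + n * τ2)) := by gcongr
      _ = _ := by rw [this]; ring
  set B := ∑ k ∈ S, ‖b k‖ ^ 2 with hB
  have hu2 := norm_sq_coef u
  have hu4 : ‖u‖ ^ 2 ≤ 4 := by nlinarith [norm_nonneg u]
  -- the dual weight sum
  have hbn : ∀ l, ‖b l‖ ^ 2 = ((ω l) ^ 2)⁻¹ * ‖u l‖ ^ 2 := by
    intro l; simp [hb, mul_pow]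
  have hYb : HasSum (fun l => (if l ∈ S then ‖b l‖ ^ 2 / τ2 else 0) + ‖u l‖ ^ 2 / n)
      (B / τ2 + ‖u‖ ^ 2 / n) := by
    refine HasSum.add ?_ (hu2.div_const _)
    have h1 : HasSum (fun l => if l ∈ S then ‖b l‖ ^ 2 / τ2 else 0)
      (∑ l ∈ S, if l ∈ S then ‖b l‖ ^ 2 / τ2 else 0) :=
      hasSum_sum_of_ne_finset_zero (fun l hl => by simp [hl])
    convert h1 using 1
    rw [hB, Finset.sum_div]
    exact Finset.sum_congr rfl fun l hl => by simp [hl]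
  have hYle : ∀ l, ‖b l‖ ^ 2 / w l ≤ (if l ∈ S then ‖b l‖ ^ 2 / τ2 else 0) + ‖u l‖ ^ 2 / n := by
    intro l
    simp only [hw]
    split_ifs with h
    · have : 0 ≤ ‖u l‖ ^ 2 / n := by positivity
      linarith
    · rw [hbn]
      have := (hpos l).ne'
      apply le_of_eq
      field_simp
      ring
  have hYs : Summable fun l => ‖b l‖ ^ 2 / w l :=
    Summable.of_nonneg_of_le (fun l => by have := hwpos l; positivity) hYle hYb.summable
  have hY : ∑' l, ‖b l‖ ^ 2 / w l ≤ B / τ2 + 4 / n := by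
    calc _ ≤ B / τ2 + ‖u‖ ^ 2 / n := by
          rw [← hYb.tsum_eq]; exact hYs.tsum_le_tsum hYle hYb.summable
      _ ≤ _ := by gcongr
  have hY0 : 0 ≤ ∑' l, ‖b l‖ ^ 2 / w l :=
    tsum_nonneg fun l => by have := hwpos l; positivity
  have hk : ∀ k : S, (M:ℝ) ^ 2 * ‖b k‖ ^ 2 ≤
      (∑' l, ‖b l‖ ^ 2 / w l) * ∑' l, W (k, l) * ‖D (l - k)‖ ^ 2 := by
    intro k
    have h1 : HasSum (fun l => b l * D (l - k)) 0 := by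
      have h2 : HasSum (fun l => ∑ i, (starRingEnd ℂ) (ee k (x i)) * (b l * ee l (x i)))
        (∑ i, (starRingEnd ℂ) (ee k (x i)) * 0) := by
        refine hasSum_sum fun i _ => ?_
        refine HasSum.mul_left _ ?_
        rw [← hz i, torus_eq]
        exact (hbe (x i)).hasSum
      convert h2 using 1
      · ext l
        simp only [hD, Finset.mul_sum, ee_sub]
        refine Finset.sum_congr rfl fun i _ => ?_
        ring
      · simp
    have h3 := h1.summable.tsum_eq_add_tsum_ite (k : Fin d → ℤ)
    rw [h1.tsum_eq, sub_self] at h3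
    have hD0 : D 0 = M := by simp [hD, ee_zero]
    rw [hD0] at h3
    have h4 : (M : ℂ) * b k = - ∑' l : Fin d → ℤ, if l = k then 0 else b l * D (l - k) := by
      linear_combination -h3
    have q1 : ∀ l, (‖b l‖ / √(w l)) ^ 2 = ‖b l‖ ^ 2 / w l := by
      intro l; rw [div_pow, Real.sq_sqrt (hwpos l).le]
    have q2 : ∀ l, (√(W (k, l)) * ‖D (l - k)‖) ^ 2 = W (k, l) * ‖D (l - k)‖ ^ 2 := by
      intro l; rw [mul_pow, Real.sq_sqrt (hW0 _)]
    have hcs := cs_tsum (fun l => ‖b l‖ / √(w l)) (fun l => √(W (k, l)) * ‖D (l - k)‖)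
      (fun l => div_nonneg (norm_nonneg _) (Real.sqrt_nonneg _))
      (fun l => mul_nonneg (Real.sqrt_nonneg _) (norm_nonneg _))
      (by simp_rw [q1]; exact hYs)
      (by simp_rw [q2]; exact hfib k)
    have e : ∀ l : Fin d → ℤ, ‖(if l = k then 0 else b l * D (l - k) : ℂ)‖ =
      ‖b l‖ / √(w l) * (√(W (k, l)) * ‖D (l - k)‖) := by
      intro l
      simp only [W]
      split_ifs with h
      · simp
      · have := (Real.sqrt_pos.2 (hwpos l)).ne'
        rw [norm_mul]
        field_simp
    have h5 : (M:ℝ) * ‖b k‖ ≤ ∑' l, ‖b l‖ / √(w l) * (√(W (k, l)) * ‖D (l - k)‖) := by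
      have : ‖(M : ℂ) * b k‖ = M * ‖b k‖ := by simp
      rw [← this, h4, norm_neg]
      simp_rw [← e]
      exact norm_tsum_le_tsum_norm (by simp_rw [e]; exact hcs.1)
    calc (M:ℝ) ^ 2 * ‖b k‖ ^ 2 = (M * ‖b k‖) ^ 2 := by ring
      _ ≤ _ := pow_le_pow_left₀ (mul_nonneg (Nat.cast_nonneg _) (norm_nonneg _)) h5 2
      _ ≤ _ := hcs.2
      _ = _ := by simp_rw [q1, q2]
  have hMB : (M:ℝ) ^ 2 * B ≤ (B / τ2 + 4 / n) * (M ^ 2 * τ2 / 4) := by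
    calc (M:ℝ) ^ 2 * B = ∑ k : S, (M:ℝ) ^ 2 * ‖b k‖ ^ 2 := by
          rw [hB, Finset.mul_sum, ← Finset.sum_coe_sort]
      _ ≤ ∑ k : S, (∑' l, ‖b l‖ ^ 2 / w l) * ∑' l, W (k, l) * ‖D (l - k)‖ ^ 2 :=
          Finset.sum_le_sum fun k _ => hk k
      _ = (∑' l, ‖b l‖ ^ 2 / w l) * ∑ k : S, ∑' l, W (k, l) * ‖D (l - k)‖ ^ 2 := by
          rw [Finset.mul_sum]
      _ ≤ (∑' l, ‖b l‖ ^ 2 / w l) * (M ^ 2 * τ2 / 4) := by gcongr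
      _ ≤ _ := by gcongr
  have hMpos : (0:ℝ) < M := by rw [hM]; positivity
  have e2 : (B / τ2 + 4 / n) * (M ^ 2 * τ2 / 4) = M ^ 2 * (B / 4 + τ2 / n) := by
    field_simp
  rw [e2] at hMB
  have h6 : B ≤ B / 4 + τ2 / n := le_of_mul_le_mul_left hMB (by positivity)
  have h7 : n * B ≤ n * (B / 4 + τ2 / n) := by gcongr
  have h8 : n * (B / 4 + τ2 / n) = n * B / 4 + τ2 := by field_simp
  linarith

theorem upper {d : ℕ} (ω : (Fin d → ℤ) → ℝ) (hpos : ∀ k, 0 < ω k)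
    (hs : Summable fun k => ((ω k) ^ 2)⁻¹) (S : Finset (Fin d → ℤ))
    (τ2 : ℝ) (hτ : HasSum (fun k => if k ∈ S then 0 else ((ω k) ^ 2)⁻¹) τ2) (hτ0 : 0 < τ2) :
    wcErr ω (stdInfo ω) (8 * S.card ^ 2) ≤ ENNReal.ofReal (4 * √τ2) := by
  classical
  have main : ∃ x : Fin (8 * S.card ^ 2) → Fin d → ℝ, (∀ i, x i ∈ cube d) ∧
      ∀ u : Coef d, ‖u‖ ≤ 2 → (∀ i, torusFn ω u (x i) = 0) →
        S.card * ∑ k ∈ S, ‖((ω k : ℂ))⁻¹ * u k‖ ^ 2 ≤ 4 / 3 * τ2 := by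
    rcases Nat.eq_zero_or_pos S.card with h | h
    · refine ⟨fun _ => 0, fun _ j => by simp, fun u _ _ => ?_⟩
      rw [h]; simp; positivity
    · exact points ω hpos hs S h τ2 hτ hτ0
  obtain ⟨x, hx, hxu⟩ := main
  have hinf : ∀ u : Coef d, ‖u‖ ≤ 2 → (∀ i, torusFn ω u (x i) = 0) → ∀ y,
      ‖torusFn ω u y‖ ≤ 4 * √τ2 := by
    intro u hu hz y
    have h1 := hxu u hu hz
    have hbs := summ_b hs u
    set b : (Fin d → ℤ) → ℂ := fun k => ((ω k : ℂ))⁻¹ * u k with hb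
    have h2 : ‖torusFn ω u y‖ ≤ ∑' k, ‖b k‖ := by
      rw [torus_eq]
      have := norm_tsum_le_tsum_norm (f := fun k => b k * ee k y)
        (by simpa only [norm_mul _ (ee _ _), ee_norm, mul_one] using hbs)
      simpa only [norm_mul _ (ee _ _), ee_norm, mul_one] using this
    have hu2 := norm_sq_coef u
    have hu4 : ‖u‖ ^ 2 ≤ 4 := by nlinarith [norm_nonneg u]
    obtain ⟨hc1, hc2⟩ := cs_tsum (fun k => if k ∈ S then 0 else (ω k)⁻¹) (fun k => ‖u k‖)
      (fun k => by have := hpos k; split_ifs <;> positivity) (fun k => norm_nonneg _)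
      (by simpa [ite_pow] using hτ.summable) hu2.summable
    have h3 : ∑' k, (if k ∈ S then 0 else (ω k)⁻¹) ^ 2 = τ2 := by
      rw [← hτ.tsum_eq]; congr 1; ext1 k; split_ifs <;> simp
    rw [h3, hu2.tsum_eq] at hc2
    have h4 : HasSum (fun k => if k ∈ S then ‖b k‖ else 0) (∑ k ∈ S, if k ∈ S then ‖b k‖ else 0) :=
      hasSum_sum_of_ne_finset_zero (fun l hl => by simp [hl])
    have h5 : (∑ k ∈ S, if k ∈ S then ‖b k‖ else 0) = ∑ k ∈ S, ‖b k‖ :=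
      Finset.sum_congr rfl fun l hl => by simp [hl]
    rw [h5] at h4
    have h6 : ∑' k, ‖b k‖ = ∑ k ∈ S, ‖b k‖ + ∑' k, (if k ∈ S then 0 else (ω k)⁻¹) * ‖u k‖ := by
      rw [← (h4.add hc1.hasSum).tsum_eq]
      congr 1; ext1 k
      split_ifs
      · simp
      · simp [hb, abs_of_pos (hpos k)]
    have h7 : (∑ k ∈ S, ‖b k‖) ^ 2 ≤ 4 / 3 * τ2 := sq_sum_le_card_mul_sum_sq.trans h1
    have h8 : (√τ2) ^ 2 = τ2 := Real.sq_sqrt hτ0.le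
    have h9 : 0 ≤ √τ2 := Real.sqrt_nonneg _
    have h10 : ∑ k ∈ S, ‖b k‖ ≤ 2 * √τ2 := by
      apply le_of_sq_le_sq _ (by positivity)
      nlinarith
    have h11 : ∑' k, (if k ∈ S then 0 else (ω k)⁻¹) * ‖u k‖ ≤ 2 * √τ2 := by
      apply le_of_sq_le_sq _ (by positivity)
      nlinarith
    linarith
  unfold wcErr
  let φ : (Fin (8 * S.card ^ 2) → ℂ) → (Fin d → ℝ) → ℂ := fun y =>
    if h : ∃ v : Coef d, ‖v‖ ≤ 1 ∧ ∀ i, torusFn ω v (x i) = y i then torusFn ω h.choose else 0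
  refine (iInf_le _ (fun i u => torusFn ω u (x i))).trans ?_
  refine (iInf_le _ (fun i => ⟨x i, hx i, rfl⟩)).trans ?_
  refine (iInf_le _ φ).trans ?_
  refine iSup_le fun u => iSup_le fun hu => iSup_le fun y => iSup_le fun hy => ?_
  have hex : ∃ v : Coef d, ‖v‖ ≤ 1 ∧ ∀ i, torusFn ω v (x i) = torusFn ω u (x i) :=
    ⟨u, hu, fun i => rfl⟩
  have hφ : φ (fun i => torusFn ω u (x i)) = torusFn ω hex.choose := dif_pos hex
  rw [hφ, ← torus_sub hs, ← enorm_eq_nnnorm, ← ofReal_norm]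
  apply ENNReal.ofReal_le_ofReal
  apply hinf
  · refine (norm_sub_le _ _).trans ?_
    linarith [hex.choose_spec.1]
  · intro i
    rw [torus_sub hs, hex.choose_spec.2 i, sub_self]

theorem hilb {E : Type*} [NormedAddCommGroup E] [InnerProductSpace ℂ E] [CompleteSpace E]
    {n : ℕ} (T : Fin n → E →L[ℂ] ℂ) :
    ∃ (N : ℕ) (q : Fin N → E), N ≤ n ∧ Orthonormal ℂ q ∧ ∀ r : E, ∃ z : E, (∀ i, T i z = 0) ∧
      inner ℂ r z = ((‖z‖ ^ 2 : ℝ) : ℂ) ∧ ‖z‖ ^ 2 = ‖r‖ ^ 2 - ∑ i, ‖inner ℂ (q i) r‖ ^ 2 := by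
  let v : Fin n → E := fun i => (InnerProductSpace.toDual ℂ E).symm (T i)
  let K : Submodule ℂ E := Submodule.span ℂ (Set.range v)
  have hfin : FiniteDimensional ℂ K := FiniteDimensional.span_of_finite ℂ (Set.finite_range v)
  let q := stdOrthonormalBasis ℂ K
  refine ⟨Module.finrank ℂ K, fun i => (q i : E), ?_, ?_, ?_⟩
  · have := finrank_range_le_card (R := ℂ) v
    rw [Fintype.card_fin] at this
    exact this
  · exact q.orthonormal.comp_linearIsometry K.subtypeₗᵢ
  · intro r
    have hz : r - K.starProjection r ∈ Kᗮ := K.sub_starProjection_mem_orthogonal r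
    have hP : K.starProjection r ∈ K := K.starProjection_apply_mem r
    have h0 : inner ℂ (K.starProjection r) (r - K.starProjection r) = 0 :=
      (Submodule.mem_orthogonal K _).1 hz _ hP
    refine ⟨r - K.starProjection r, ?_, ?_, ?_⟩
    · intro i
      have h1 : inner ℂ (v i) (r - K.starProjection r) = 0 :=
        (Submodule.mem_orthogonal K _).1 hz _ (Submodule.subset_span ⟨i, rfl⟩)
      have : inner ℂ (v i) (r - K.starProjection r) = T i (r - K.starProjection r) :=
        InnerProductSpace.toDual_symm_apply
      rw [← this, h1]
    · have : inner ℂ r (r - K.starProjection r) =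
        inner ℂ (r - K.starProjection r) (r - K.starProjection r) := by
        rw [inner_sub_left r, h0, sub_zero]
      rw [this, inner_self_eq_norm_sq_to_K]
      norm_cast
    · have h2 : ‖r‖ ^ 2 = ‖K.starProjection r‖ ^ 2 + ‖r - K.starProjection r‖ ^ 2 := by
        have := norm_add_sq_eq_norm_sq_add_norm_sq_of_inner_eq_zero (𝕜 := ℂ) _ _ h0
        rw [add_sub_cancel] at this
        simpa [sq] using this
      have h3 : ∑ i, ‖inner ℂ (q i : E) r‖ ^ 2 = ‖K.starProjection r‖ ^ 2 := by
        have := q.sum_sq_norm_inner_right (K.orthogonalProjectionOnto r)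
        simp only [Submodule.inner_orthogonalProjectionOnto_eq_of_mem_left] at this
        rw [this]; rfl
      rw [h3, h2]; ring

set_option maxHeartbeats 1000000 in
theorem parseval_avg {d N : ℕ} (b : Fin N → (Fin d → ℤ) → ℂ)
    (hb : ∀ i, Summable fun k => ‖b i k‖) :
    ∃ x ∈ cube d, ∑ i, ‖∑' k, b i k * ee k x‖ ^ 2 ≤ ∑ i, ∑' k, ‖b i k‖ ^ 2 := by
  have hpi : ∀ i, Summable fun p : (Fin d → ℤ) × (Fin d → ℤ) =>
      ‖b i p.1 * (starRingEnd ℂ) (b i p.2)‖ := by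
    intro i
    have := (hb i).mul_of_nonneg (hb i) (fun _ => norm_nonneg _) (fun _ => norm_nonneg _)
    simpa using this
  have hc : Summable fun p : (Fin d → ℤ) × (Fin d → ℤ) =>
      ‖∑ i, b i p.1 * (starRingEnd ℂ) (b i p.2)‖ :=
    Summable.of_nonneg_of_le (fun _ => norm_nonneg _) (fun p => norm_sum_le _ _)
      (summable_sum fun i _ => hpi i)
  obtain ⟨x, hx, hle⟩ := avg (fun p : (Fin d → ℤ) × (Fin d → ℤ) =>
    ∑ i, b i p.1 * (starRingEnd ℂ) (b i p.2)) (fun p => p.1 - p.2) hc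
  refine ⟨x, hx, ?_⟩
  have hbe : ∀ i, Summable fun k => ‖b i k * ee k x‖ := by
    intro i; simpa only [norm_mul, ee_norm, mul_one] using hb i
  have e1 : ∑' p : (Fin d → ℤ) × (Fin d → ℤ),
      (∑ i, b i p.1 * (starRingEnd ℂ) (b i p.2)) * ee (p.1 - p.2) x =
      ((∑ i, ‖∑' k, b i k * ee k x‖ ^ 2 : ℝ) : ℂ) := by
    have h1 : ∀ p : (Fin d → ℤ) × (Fin d → ℤ),
      (∑ i, b i p.1 * (starRingEnd ℂ) (b i p.2)) * ee (p.1 - p.2) x =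
      ∑ i, (b i p.1 * ee p.1 x) * (starRingEnd ℂ) (b i p.2 * ee p.2 x) := by
      intro p
      rw [Finset.sum_mul]
      refine Finset.sum_congr rfl fun i _ => ?_
      rw [ee_sub, map_mul]; ring
    simp_rw [h1]
    have hbe' : ∀ i, Summable fun k => ‖(starRingEnd ℂ) (b i k * ee k x)‖ := by
      intro i; simpa only [RCLike.norm_conj] using hbe i
    have hmulT : ∀ i, (∑' k, b i k * ee k x) * (∑' k, (starRingEnd ℂ) (b i k * ee k x)) =
        ∑' p : (Fin d → ℤ) × (Fin d → ℤ),
          (b i p.1 * ee p.1 x) * (starRingEnd ℂ) (b i p.2 * ee p.2 x) := fun i =>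
      tsum_mul_tsum_of_summable_norm (f := fun k => b i k * ee k x)
        (g := fun k => (starRingEnd ℂ) (b i k * ee k x)) (hbe i) (hbe' i)
    rw [Summable.tsum_finsetSum]
    · push_cast
      refine Finset.sum_congr rfl fun i _ => ?_
      rw [← hmulT i, ← Complex.conj_tsum,
        Complex.mul_conj, Complex.normSq_eq_norm_sq]
      push_cast; rfl
    · intro i _
      exact summable_mul_of_summable_norm (f := fun k => b i k * ee k x)
        (g := fun k => (starRingEnd ℂ) (b i k * ee k x)) (hbe i) (hbe' i)
  have e2 : (∑' p : (Fin d → ℤ) × (Fin d → ℤ),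
      if p.1 - p.2 = 0 then ∑ i, b i p.1 * (starRingEnd ℂ) (b i p.2) else 0) =
      ((∑ i, ∑' k, ‖b i k‖ ^ 2 : ℝ) : ℂ) := by
    have hs : Summable fun p : (Fin d → ℤ) × (Fin d → ℤ) =>
      if p.1 - p.2 = 0 then ∑ i, b i p.1 * (starRingEnd ℂ) (b i p.2) else 0 := by
      refine Summable.of_norm_bounded hc fun p => ?_
      split_ifs
      · rfl
      · simp
    rw [hs.tsum_prod]
    have h1 : ∀ k : Fin d → ℤ, (∑' l, if k - l = 0 then ∑ i, b i k * (starRingEnd ℂ) (b i l) else 0)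
      = ((∑ i, ‖b i k‖ ^ 2 : ℝ) : ℂ) := by
      intro k
      rw [tsum_eq_single k]
      · simp [Complex.mul_conj, Complex.normSq_eq_norm_sq]
      · intro l hl
        rw [if_neg]
        intro h; exact hl (sub_eq_zero.1 h).symm
    simp_rw [h1]
    rw [← Complex.ofReal_tsum, Summable.tsum_finsetSum]
    intro i _
    refine Summable.of_norm_bounded_eventually (g := fun k => ‖b i k‖) (hb i) ?_
    have := (hb i).tendsto_cofinite_zero.eventually (Iio_mem_nhds zero_lt_one)
    filter_upwards [this] with k hk
    have hk' : ‖b i k‖ < 1 := hk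
    rw [Real.norm_of_nonneg (sq_nonneg _)]
    nlinarith [norm_nonneg (b i k)]
  rw [e1, e2] at hle
  exact_mod_cast hle

theorem top_set {ι : Type*} [Infinite ι] (a : ι → ℝ) (ha : ∀ k, 0 < a k) (hs : Summable a) (n : ℕ) :
    ∃ S : Finset ι, S.card = n ∧ ∃ lam : ℝ, 0 ≤ lam ∧ (∀ k ∈ S, lam ≤ a k) ∧
      ∀ k, k ∉ S → a k ≤ lam := by
  classical
  induction n with
  | zero =>
    refine ⟨∅, rfl, ∑' k, a k, tsum_nonneg fun k => (ha k).le, by simp, fun k _ => ?_⟩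
    exact hs.le_tsum k fun j _ => (ha j).le
  | succ n ih =>
    obtain ⟨S, hS, lam, hl, h1, h2⟩ := ih
    obtain ⟨k0, hk0⟩ := Infinite.exists_notMem_finset S
    have hfin : {k | a k0 ≤ a k}.Finite := by
      have := hs.tendsto_cofinite_zero.eventually (Iio_mem_nhds (ha k0))
      rw [Filter.eventually_cofinite] at this
      refine this.subset fun k hk => ?_
      have hk' : a k0 ≤ a k := hk
      exact fun h => absurd (show a k < a k0 from h) (not_lt.2 hk')
    obtain ⟨k1, hk1, hmax⟩ := (hfin.toFinset \ S).exists_max_image a ⟨k0, by simp [hk0]⟩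
    simp only [Finset.mem_sdiff, Set.Finite.mem_toFinset] at hk1 hmax
    refine ⟨insert k1 S, by rw [Finset.card_insert_of_notMem hk1.2, hS], a k1, (ha k1).le, ?_, ?_⟩
    · intro k hk
      rcases Finset.mem_insert.1 hk with h | h
      · rw [h]
      · exact (h2 k1 hk1.2).trans (h1 k h)
    · intro k hk
      rw [Finset.mem_insert, not_or] at hk
      by_cases h : a k0 ≤ a k
      · exact hmax k ⟨h, hk.2⟩
      · exact (not_le.1 h).le.trans hk1.1

theorem lower {d : ℕ} (ω : (Fin d → ℤ) → ℝ) (hpos : ∀ k, 0 < ω k)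
    (hs : Summable fun k => ((ω k) ^ 2)⁻¹) (S : Finset (Fin d → ℤ))
    (τ2 : ℝ) (hτ : HasSum (fun k => if k ∈ S then 0 else ((ω k) ^ 2)⁻¹) τ2)
    (lam : ℝ) (hl : 0 ≤ lam) (h1 : ∀ k ∈ S, lam ≤ ((ω k) ^ 2)⁻¹)
    (h2 : ∀ k, k ∉ S → ((ω k) ^ 2)⁻¹ ≤ lam)
    (T : Fin S.card → Coef d →L[ℂ] ℂ) :
    ∃ u : Coef d, ‖u‖ ≤ 1 ∧ (∀ i, T i u = 0) ∧ ∃ x ∈ cube d, √τ2 ≤ ‖torusFn ω u x‖ := by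
  classical
  obtain ⟨N, q, hN, hq, hr⟩ := hilb T
  obtain ⟨x, hx, hle⟩ := parseval_avg (fun i k => ((ω k : ℂ))⁻¹ * q i k) (fun i => summ_b hs (q i))
  have hmem : Memℓp (fun k => ((ω k : ℂ))⁻¹ * (starRingEnd ℂ) (ee k x)) 2 := by
    apply memℓp_gen
    simpa [ee_norm] using hs
  let r : Coef d := ⟨_, hmem⟩
  have hrk : ∀ k, r k = ((ω k : ℂ))⁻¹ * (starRingEnd ℂ) (ee k x) := fun k => rfl
  have hin : ∀ u : Coef d, inner ℂ r u = torusFn ω u x := by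
    intro u
    rw [lp.inner_eq_tsum, torus_eq]
    congr 1; ext1 k
    rw [hrk, RCLike.inner_apply, map_mul, Complex.conj_conj, map_inv₀, Complex.conj_ofReal]
    ring
  have hrn : ‖r‖ ^ 2 = ∑' k, ((ω k) ^ 2)⁻¹ := by
    rw [← (norm_sq_coef r).tsum_eq]
    congr 1; ext1 k
    rw [hrk]; simp [ee_norm]
  obtain ⟨z, hz1, hz2, hz3⟩ := hr r
  -- the weight bound
  have hw1 : ∀ k, ∑ i, ‖q i k‖ ^ 2 ≤ 1 := by
    intro k
    have := hq.sum_inner_products_le (s := Finset.univ) (x := (lp.single 2 k (1:ℂ) : Coef d))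
    rw [lp.norm_single (by norm_num)] at this
    simpa [lp.inner_single_right] using this
  have hwN : HasSum (fun k => ∑ i, ‖q i k‖ ^ 2) N := by
    have : HasSum (fun k => ∑ i, ‖q i k‖ ^ 2) (∑ i, ‖q i‖ ^ 2) :=
      hasSum_sum fun i _ => norm_sq_coef (q i)
    simpa [hq.1] using this
  have hsq : ∀ i, Summable fun k => ‖((ω k : ℂ))⁻¹ * q i k‖ ^ 2 := by
    intro i
    refine Summable.of_nonneg_of_le (fun k => sq_nonneg _) (fun k => ?_) hs
    have hk1 := hw1 k
    have : ‖q i k‖ ^ 2 ≤ ∑ i, ‖q i k‖ ^ 2 :=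
      Finset.single_le_sum (f := fun i => ‖q i k‖ ^ 2) (fun _ _ => sq_nonneg _) (Finset.mem_univ i)
    have h3 : ‖((ω k : ℂ))⁻¹ * q i k‖ ^ 2 = ((ω k) ^ 2)⁻¹ * ‖q i k‖ ^ 2 := by
      simp [mul_pow]
    rw [h3]
    have h4 : 0 ≤ ((ω k) ^ 2)⁻¹ := by positivity
    nlinarith
  have hA : HasSum (fun k => ∑ i, ‖((ω k : ℂ))⁻¹ * q i k‖ ^ 2)
      (∑ i, ∑' k, ‖((ω k : ℂ))⁻¹ * q i k‖ ^ 2) :=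
    hasSum_sum fun i _ => (hsq i).hasSum
  have hB : HasSum (fun k => (if k ∈ S then ((ω k) ^ 2)⁻¹ - lam else 0) +
      lam * ∑ i, ‖q i k‖ ^ 2) (∑ k ∈ S, (((ω k) ^ 2)⁻¹ - lam) + lam * N) := by
    refine HasSum.add ?_ (hwN.mul_left lam)
    have h4 : HasSum (fun k => if k ∈ S then ((ω k) ^ 2)⁻¹ - lam else 0)
      (∑ k ∈ S, if k ∈ S then ((ω k) ^ 2)⁻¹ - lam else 0) :=
      hasSum_sum_of_ne_finset_zero (fun l hl => by simp [hl])
    convert h4 using 1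
    exact Finset.sum_congr rfl fun l hl => by simp [hl]
  have hAB := hasSum_le (fun k => ?_) hA hB
  swap
  · have h3 : ∑ i, ‖((ω k : ℂ))⁻¹ * q i k‖ ^ 2 = ((ω k) ^ 2)⁻¹ * ∑ i, ‖q i k‖ ^ 2 := by
      simp [mul_pow, Finset.mul_sum]
    rw [h3]
    have h4 : 0 ≤ ∑ i, ‖q i k‖ ^ 2 := Finset.sum_nonneg fun _ _ => sq_nonneg _
    have h5 := hw1 k
    split_ifs with h
    · nlinarith [h1 k h]
    · nlinarith [h2 k h]
  have hS : ∑ k ∈ S, (((ω k) ^ 2)⁻¹ - lam) + lam * N ≤ ∑ k ∈ S, ((ω k) ^ 2)⁻¹ := by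
    rw [Finset.sum_sub_distrib]
    simp only [Finset.sum_const, nsmul_eq_mul]
    have : (N:ℝ) ≤ S.card := by exact_mod_cast hN
    nlinarith
  have htot : ∑' k, ((ω k) ^ 2)⁻¹ = τ2 + ∑ k ∈ S, ((ω k) ^ 2)⁻¹ := by
    have h4 : HasSum (fun k => if k ∈ S then ((ω k) ^ 2)⁻¹ else 0)
      (∑ k ∈ S, if k ∈ S then ((ω k) ^ 2)⁻¹ else 0) :=
      hasSum_sum_of_ne_finset_zero (fun l hl => by simp [hl])
    have h5 : (∑ k ∈ S, if k ∈ S then ((ω k) ^ 2)⁻¹ else 0) = ∑ k ∈ S, ((ω k) ^ 2)⁻¹ :=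
      Finset.sum_congr rfl fun l hl => by simp [hl]
    rw [← h5, ← (hτ.add h4).tsum_eq]
    congr 1; ext1 k; split_ifs <;> simp
  have hqr : ∀ i, ‖inner ℂ (q i) r‖ = ‖∑' k, ((ω k : ℂ))⁻¹ * q i k * ee k x‖ := by
    intro i
    rw [norm_inner_symm, hin, torus_eq]
  have hzt : τ2 ≤ ‖z‖ ^ 2 := by
    rw [hz3, hrn, htot]
    simp_rw [hqr]
    linarith
  have hzn : √τ2 ≤ ‖z‖ := by
    rw [← Real.sqrt_sq (norm_nonneg z)]; exact Real.sqrt_le_sqrt hzt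
  refine ⟨((‖z‖⁻¹ : ℝ) : ℂ) • z, ?_, ?_, x, hx, ?_⟩
  · rw [norm_smul, Complex.norm_real, norm_inv, norm_norm]
    exact inv_mul_le_one
  · intro i; simp [hz1 i]
  · rw [← hin, inner_smul_right, hz2, ← Complex.ofReal_mul, Complex.norm_real]
    refine hzn.trans (le_of_eq ?_)
    rcases eq_or_ne ‖z‖ 0 with h | h
    · simp [h]
    · rw [sq, inv_mul_cancel_left₀ h, norm_norm]

theorem tail_pos {d : ℕ} [NeZero d] (ω : (Fin d → ℤ) → ℝ) (hpos : ∀ k, 0 < ω k)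
    (hs : Summable fun k => ((ω k) ^ 2)⁻¹) (S : Finset (Fin d → ℤ)) :
    ∃ τ2 : ℝ, HasSum (fun k => if k ∈ S then 0 else ((ω k)^2)⁻¹) τ2 ∧ 0 < τ2 := by
  have h : Summable (fun k => if k ∈ S then 0 else ((ω k)^2)⁻¹) := by
    refine Summable.of_nonneg_of_le (fun k => ?_) (fun k => ?_) hs
    · split_ifs <;> positivity
    · split_ifs <;> first | positivity | exact le_rfl
  refine ⟨_, h.hasSum, ?_⟩
  obtain ⟨k, hk⟩ := Infinite.exists_notMem_finset S
  refine h.tsum_pos (fun k => by split_ifs <;> positivity) k ?_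
  have := hpos k
  simp only [hk, if_false]; positivity

theorem sup_ge {d : ℕ} (ω : (Fin d → ℤ) → ℝ)
    (hs : Summable fun k => ((ω k) ^ 2)⁻¹) (u : Coef d) (hu : ‖u‖ ≤ 1) (x : Fin d → ℝ)
    (hx : x ∈ cube d) (n : ℕ) (L : Fin n → Coef d → ℂ) (hL : ∀ i, L i ∈ allInfo d)
    (h0 : ∀ i, L i u = 0) (φ : (Fin n → ℂ) → (Fin d → ℝ) → ℂ) (r : ℝ) (hr : r ≤ ‖torusFn ω u x‖) :
    ENNReal.ofReal r ≤ ⨆ (u : Coef d) (_ : ‖u‖ ≤ 1) (x : Fin d → ℝ) (_ : x ∈ cube d),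
      (‖torusFn ω u x - φ (fun i => L i u) x‖₊ : ℝ≥0∞) := by
  have hneg : torusFn ω (-u) x = - torusFn ω u x := by
    have h1 := torus_sub hs 0 u x
    have h2 := torus_sub hs 0 0 x
    simp only [sub_self] at h2
    rw [h2] at h1
    simpa using h1
  have hLn : ∀ i, L i (-u) = 0 := by
    intro i
    obtain ⟨T, hT⟩ := hL i
    have := h0 i
    rw [hT] at this ⊢
    rw [map_neg, this, neg_zero]
  have e1 : (fun i => L i u) = fun _ => 0 := funext h0
  have e2 : (fun i => L i (-u)) = fun _ => 0 := funext hLn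
  set c := φ (fun _ => 0) x with hc
  have hor : r ≤ ‖torusFn ω u x - c‖ ∨ r ≤ ‖torusFn ω (-u) x - c‖ := by
    by_contra! h
    have h3 : (2:ℂ) * torusFn ω u x = (torusFn ω u x - c) - (torusFn ω (-u) x - c) := by
      rw [hneg]; ring
    have h4 := congrArg norm h3
    rw [norm_mul] at h4
    have h5 := norm_sub_le (torusFn ω u x - c) (torusFn ω (-u) x - c)
    have h6 : ‖(2:ℂ)‖ = 2 := by simp
    rw [h6] at h4
    linarith [h.1, h.2]
  have conv : ∀ z : ℂ, r ≤ ‖z‖ → ENNReal.ofReal r ≤ (‖z‖₊ : ℝ≥0∞) := by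
    intro z hz
    rw [← enorm_eq_nnnorm, ← ofReal_norm]
    exact ENNReal.ofReal_le_ofReal hz
  rcases hor with h | h
  · refine le_trans (conv _ h) ?_
    refine le_iSup₂_of_le u hu (le_iSup₂_of_le x hx ?_)
    rw [e1]
  · refine le_trans (conv _ h) ?_
    refine le_iSup₂_of_le (-u) (by rwa [norm_neg]) (le_iSup₂_of_le x hx ?_)
    rw [e2]

theorem key {d : ℕ} [NeZero d] (ω : (Fin d → ℤ) → ℝ) (hpos : ∀ k, 0 < ω k)
    (hs : Summable fun k => ((ω k) ^ 2)⁻¹) (n : ℕ) :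
    wcErr ω (stdInfo ω) (8 * n ^ 2) ≤ 4 * wcErr ω (allInfo d) n := by
  obtain ⟨S, rfl, lam, hl, h1, h2⟩ := top_set (fun k => ((ω k) ^ 2)⁻¹)
    (fun k => by have := hpos k; positivity) hs n
  obtain ⟨τ2, hτ, hτ0⟩ := tail_pos ω hpos hs S
  refine (upper ω hpos hs S τ2 hτ hτ0).trans ?_
  rw [ENNReal.ofReal_mul (by norm_num)]
  have : ENNReal.ofReal 4 = 4 := by norm_num
  rw [this]
  gcongr
  refine le_iInf fun L => le_iInf fun hL => le_iInf fun φ => ?_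
  choose T hT using hL
  obtain ⟨u, hu, h0, x, hx, hr⟩ := lower ω hpos hs S τ2 hτ lam hl h1 h2 T
  exact sup_ge ω hs u hu x hx _ L (fun i => ⟨T i, hT i⟩) (fun i => by rw [hT i]; exact h0 i) φ _ hr

theorem cri_pos {d : ℕ} [NeZero d] (ω : (Fin d → ℤ) → ℝ) (hpos : ∀ k, 0 < ω k)
    (hs : Summable fun k => ((ω k) ^ 2)⁻¹) (crit : Crit) : 0 < CRI ω crit := by
  cases crit with
  | ABS => exact one_pos
  | NOR =>
    obtain ⟨τ2, hτ, hτ0⟩ := tail_pos ω hpos hs ∅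
    obtain ⟨u, hu, h0, x, hx, hr⟩ := lower ω hpos hs ∅ τ2 hτ (∑' k, ((ω k) ^ 2)⁻¹)
      (tsum_nonneg fun k => by positivity) (by simp)
      (fun k _ => hs.le_tsum k fun j _ => by positivity) (fun _ => 0)
    change 0 < initErr ω
    have h3 : 0 < ‖torusFn ω u x‖ := lt_of_lt_of_le (Real.sqrt_pos.2 hτ0) hr
    have h4 : (0:ℝ≥0∞) < (‖torusFn ω u x‖₊ : ℝ≥0∞) := by
      have : (0:ℝ≥0) < ‖torusFn ω u x‖₊ := h3
      exact_mod_cast this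
    refine lt_of_lt_of_le h4 ?_
    exact le_iSup₂_of_le u hu (le_iSup₂_of_le x hx le_rfl)

theorem std_nonempty {d : ℕ} [NeZero d] (ω : (Fin d → ℤ) → ℝ) (hpos : ∀ k, 0 < ω k)
    (hs : Summable fun k => ((ω k) ^ 2)⁻¹) (crit : Crit) (ε : ℝ) (hε : 0 < ε) :
    ∃ n, wcErr ω (stdInfo ω) n ≤ ENNReal.ofReal ε * CRI ω crit := by
  have hP : 0 < ENNReal.ofReal ε * CRI ω crit :=
    ENNReal.mul_pos (ENNReal.ofReal_pos.2 hε).ne' (cri_pos ω hpos hs crit).ne'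
  obtain ⟨δ, hδ0, hδ⟩ := ENNReal.lt_iff_exists_nnreal_btwn.1 hP
  have hδ0' : (0:ℝ) < δ := by exact_mod_cast hδ0
  have ht := hs.hasSum
  have hev : ∀ᶠ S : Finset (Fin d → ℤ) in atTop,
      ∑' k, ((ω k) ^ 2)⁻¹ - ((δ:ℝ) / 4) ^ 2 < ∑ k ∈ S, ((ω k) ^ 2)⁻¹ :=
    ht.eventually (lt_mem_nhds (by have : 0 < ((δ:ℝ) / 4) ^ 2 := by positivity
                                   linarith))
  obtain ⟨S, hS⟩ := hev.exists
  obtain ⟨τ2, hτ, hτ0⟩ := tail_pos ω hpos hs S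
  have htot : ∑' k, ((ω k) ^ 2)⁻¹ = τ2 + ∑ k ∈ S, ((ω k) ^ 2)⁻¹ := by
    have h4 : HasSum (fun k => if k ∈ S then ((ω k) ^ 2)⁻¹ else 0)
      (∑ k ∈ S, if k ∈ S then ((ω k) ^ 2)⁻¹ else 0) :=
      hasSum_sum_of_ne_finset_zero (fun l hl => by simp [hl])
    have h5 : (∑ k ∈ S, if k ∈ S then ((ω k) ^ 2)⁻¹ else 0) = ∑ k ∈ S, ((ω k) ^ 2)⁻¹ :=
      Finset.sum_congr rfl fun l hl => by simp [hl]
    rw [← h5, ← (hτ.add h4).tsum_eq]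
    congr 1; ext1 k; split_ifs <;> simp
  refine ⟨_, (upper ω hpos hs S τ2 hτ hτ0).trans (le_trans ?_ hδ.le)⟩
  rw [← ENNReal.ofReal_coe_nnreal]
  apply ENNReal.ofReal_le_ofReal
  have : √τ2 ≤ (δ:ℝ) / 4 := by
    rw [Real.sqrt_le_left (by positivity)]
    linarith
  linarith

theorem std_sub_all {d : ℕ} (ω : (Fin d → ℤ) → ℝ)
    (hs : Summable fun k => ((ω k) ^ 2)⁻¹) : stdInfo ω ⊆ allInfo d := by
  rintro L ⟨x, hx, rfl⟩
  have hmem : Memℓp (fun k => ((ω k : ℂ))⁻¹ * (starRingEnd ℂ) (ee k x)) 2 := by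
    apply memℓp_gen
    convert hs using 2 with k
    simp [ee_norm]
  let r : Coef d := ⟨_, hmem⟩
  have hrk : ∀ k, r k = ((ω k : ℂ))⁻¹ * (starRingEnd ℂ) (ee k x) := fun k => rfl
  refine ⟨innerSL ℂ r, ?_⟩
  funext u
  rw [innerSL_apply_apply, lp.inner_eq_tsum, torus_eq]
  congr 1; ext1 k
  rw [hrk, RCLike.inner_apply, map_mul, Complex.conj_conj, map_inv₀, Complex.conj_ofReal]
  ring

theorem all_le_std {d : ℕ} (ω : (Fin d → ℤ) → ℝ)
    (hs : Summable fun k => ((ω k) ^ 2)⁻¹) (n : ℕ) :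
    wcErr ω (allInfo d) n ≤ wcErr ω (stdInfo ω) n := by
  refine le_iInf fun L => le_iInf fun hL => le_iInf fun φ => ?_
  exact iInf₂_le_of_le L (fun i => std_sub_all ω hs (hL i)) (iInf_le _ φ)

theorem arith (L : ℝ) (hL : 0 ≤ L) :
    (1 + Real.log (L + Real.log 4 + 1)) ≤ 3 * (1 + Real.log (L + 1)) := by
  obtain ⟨y, hy⟩ : ∃ y, y = Real.log (L + 1) := ⟨_, rfl⟩
  rw [← hy]
  have hy0 : 0 ≤ y := by rw [hy]; exact Real.log_nonneg (by linarith)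
  have h4 : Real.log 4 = 2 * Real.log 2 := by
    rw [← Real.log_rpow (by norm_num)]; norm_num
  have h40 : 0 < Real.log 4 := Real.log_pos (by norm_num)
  have h41 : Real.log 4 ≤ 2 := by have := Real.log_two_lt_d9; linarith
  have h1 : L + Real.log 4 + 1 ≤ (L + 1) * 3 := by nlinarith
  have h2 := Real.log_le_log (by linarith) h1
  rw [Real.log_mul (by linarith) (by norm_num), ← hy] at h2
  have h3 : Real.log 3 ≤ 2 := by linarith [Real.log_le_sub_one_of_pos (show (0:ℝ) < 3 by norm_num)]
  linarith

/-- EXP-QPT for `Λ^all` is equivalent to EXP-QPT for `Λ^std`,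
for the absolute or normalized error criterion. -/
theorem stmt5
    (ω : (d : ℕ) → (Fin d → ℤ) → ℝ)
    (hpos : ∀ d, 0 < d → ∀ k, 0 < ω d k)
    (hsum : ∀ d, 0 < d → Summable fun k => ((ω d k) ^ 2)⁻¹)
    (crit : Crit) :
    EXPQPT (fun d ε => infoComp (ω d) (allInfo d) crit ε) ↔
      EXPQPT (fun d ε => infoComp (ω d) (stdInfo (ω d)) crit ε) := by
  constructor
  · rintro ⟨C, hC, t, ht, h⟩
    refine ⟨8 * C ^ 2, by positivity, 6 * t, by positivity, ?_⟩
    intro d hd ε hε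
    have : NeZero d := ⟨hd.ne'⟩
    have hε4 : ε / 4 ∈ Set.Ioo (0:ℝ) 1 := ⟨by linarith [hε.1], by linarith [hε.1, hε.2]⟩
    have hn := h d hd (ε / 4) hε4
    have hne : {n : ℕ | wcErr (ω d) (allInfo d) n ≤
        ENNReal.ofReal (ε / 4) * CRI (ω d) crit}.Nonempty := by
      obtain ⟨n, hn⟩ := std_nonempty (ω d) (hpos d hd) (hsum d hd) crit (ε / 4) hε4.1
      exact ⟨n, (all_le_std (ω d) (hsum d hd) n).trans hn⟩
    have hmem := Nat.sInf_mem hne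
    change wcErr (ω d) (allInfo d) (infoComp (ω d) (allInfo d) crit (ε / 4)) ≤ _ at hmem
    beta_reduce at hn ⊢
    set n := infoComp (ω d) (allInfo d) crit (ε / 4)
    have hstd : infoComp (ω d) (stdInfo (ω d)) crit ε ≤ 8 * n ^ 2 := by
      apply Nat.sInf_le
      change wcErr (ω d) (stdInfo (ω d)) (8 * n ^ 2) ≤ _
      refine (key (ω d) (hpos d hd) (hsum d hd) n).trans ?_
      calc 4 * wcErr (ω d) (allInfo d) n ≤ 4 * (ENNReal.ofReal (ε / 4) * CRI (ω d) crit) := by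
            gcongr
        _ = ENNReal.ofReal ε * CRI (ω d) crit := by
            rw [← mul_assoc]
            congr 1
            have h4 : (4:ℝ≥0∞) = ENNReal.ofReal 4 := by norm_num
            rw [h4, ← ENNReal.ofReal_mul (by norm_num)]
            congr 1; ring
    have hcast : (infoComp (ω d) (stdInfo (ω d)) crit ε : ℝ) ≤ 8 * (n:ℝ) ^ 2 := by
      exact_mod_cast hstd
    have ha : 0 ≤ 1 + Real.log d := by
      have := Real.log_nonneg (show (1:ℝ) ≤ d by exact_mod_cast hd)
      linarith
    have hL : 0 ≤ Real.log ε⁻¹ := Real.log_nonneg ((one_le_inv₀ hε.1).2 hε.2.le)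
    have hlog : Real.log (ε / 4)⁻¹ = Real.log ε⁻¹ + Real.log 4 := by
      rw [inv_div, div_eq_mul_inv, mul_comm,
        Real.log_mul (inv_ne_zero hε.1.ne') (by norm_num)]
    have hB := arith (Real.log ε⁻¹) hL
    rw [hlog] at hn
    have hE : t * (1 + Real.log d) * (1 + Real.log (Real.log ε⁻¹ + Real.log 4 + 1)) ≤
        t * (1 + Real.log d) * (3 * (1 + Real.log (Real.log ε⁻¹ + 1))) :=
      mul_le_mul_of_nonneg_left hB (mul_nonneg ht ha)
    have hn2 : (n:ℝ) ≤ C * Real.exp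
        (t * (1 + Real.log d) * (3 * (1 + Real.log (Real.log ε⁻¹ + 1)))) :=
      hn.trans (mul_le_mul_of_nonneg_left (Real.exp_le_exp.2 hE) hC.le)
    refine hcast.trans ?_
    calc 8 * (n:ℝ) ^ 2 ≤ 8 * (C * Real.exp
        (t * (1 + Real.log d) * (3 * (1 + Real.log (Real.log ε⁻¹ + 1))))) ^ 2 := by gcongr
      _ = _ := by
        rw [mul_pow, ← Real.exp_nat_mul, ← mul_assoc]
        congr 2
        push_cast
        ring
  · rintro ⟨C, hC, t, ht, h⟩
    refine ⟨C, hC, t, ht, fun d hd ε hε => le_trans ?_ (h d hd ε hε)⟩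
    have : NeZero d := ⟨hd.ne'⟩
    have hne : {n : ℕ | wcErr (ω d) (stdInfo (ω d)) n ≤
        ENNReal.ofReal ε * CRI (ω d) crit}.Nonempty :=
      std_nonempty (ω d) (hpos d hd) (hsum d hd) crit ε hε.1
    have hmem := Nat.sInf_mem hne
    have : infoComp (ω d) (allInfo d) crit ε ≤ infoComp (ω d) (stdInfo (ω d)) crit ε :=
      Nat.sInf_le ((all_le_std (ω d) (hsum d hd) _).trans hmem)
    exact_mod_cast this
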